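/- arXiv:1506.00922 — 3 statements merged into one kernel-verified Lean document; each statement's English description precedes it below -/
import Mathlib

section
/- As p → N from the right, Λ_p(Ω)/(p−N)^{p−1} converges to N ω_N/(N−1)^{N−1}. In particular, Λ_p(Ω) → 0 as p → N⁺. -/
open MeasureTheory Filter Topology Metric

noncomputable def LambdaP {N : ℕ} (Ω : Set (EuclideanSpace ℝ (Fin N))) (p : ℝ) : ℝ :=
  sInf { c : ℝ | ∃ u : EuclideanSpace ℝ (Fin N) → ℝ,
    ContDiff ℝ (⊤ : ℕ∞) u ∧ HasCompactSupport u ∧ tsupport u ⊆ Ω ∧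
    sSup ((fun x => |u x|) '' Ω) = 1 ∧
    c = ∫ x in Ω, ‖gradient u x‖ ^ p }

noncomputable def hw (a D r : ℝ) : ℝ := a * D ^ (-a) * r ^ (a - 1)

lemma hw_nonneg {a D r : ℝ} (ha : 0 < a) (hD : 0 < D) (hr : 0 ≤ r) : 0 ≤ hw a D r := by
  unfold hw; positivity

lemma hw_ii {a D : ℝ} (ha : 0 < a) : IntervalIntegrable (hw a D) volume 0 D :=
  (intervalIntegral.intervalIntegrable_rpow' (by linarith)).const_mul _

lemma hw_int {a D : ℝ} (ha : 0 < a) (hD : 0 < D) : ∫ r in (0:ℝ)..D, hw a D r = 1 := by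
  unfold hw
  rw [intervalIntegral.integral_const_mul, integral_rpow (Or.inl (by linarith))]
  simp only [sub_add_cancel, Real.zero_rpow ha.ne', sub_zero]
  rw [Real.rpow_neg hD.le]
  have := (Real.rpow_pos_of_pos hD a).ne'
  field_simp

noncomputable def cc (N : ℕ) (p D : ℝ) : ℝ := ((p - N) / (p - 1)) ^ (p - 1) * D ^ (-(p - N))

lemma hw_pow1 {N : ℕ} (hN : 2 ≤ N) {p D r : ℝ} (hp : (N:ℝ) < p) (hD : 0 < D) (hr : 0 < r) :
    hw ((p - N) / (p - 1)) D r ^ (p - 1) * r ^ (N - 1) = cc N p D := by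
  have hN' : (2:ℝ) ≤ N := by exact_mod_cast hN
  have hp1 : 0 < p - 1 := by linarith
  have ha : 0 < (p - N) / (p - 1) := div_pos (by linarith) hp1
  unfold hw cc
  rw [Real.mul_rpow (by positivity) (by positivity), Real.mul_rpow (by positivity) (by positivity),
    ← Real.rpow_mul hD.le, ← Real.rpow_mul hr.le, ← Real.rpow_natCast r (N - 1), mul_assoc (_ * _),
    ← Real.rpow_add hr]
  have e1 : -((p - N) / (p - 1)) * (p - 1) = -(p - N) := by field_simp
  have e2 : ((p - N) / (p - 1) - 1) * (p - 1) + ((N - 1 : ℕ) : ℝ) = 0 := by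
    rw [Nat.cast_sub (by omega)]; field_simp; push_cast; ring
  rw [e1, e2]; simp

lemma hw_pow {N : ℕ} (hN : 2 ≤ N) {p D r : ℝ} (hp : (N:ℝ) < p) (hD : 0 < D) (hr : 0 < r) :
    hw ((p - N) / (p - 1)) D r ^ p * r ^ (N - 1) = cc N p D * hw ((p - N) / (p - 1)) D r := by
  have hN' : (2:ℝ) ≤ N := by exact_mod_cast hN
  have hp1 : 0 < p - 1 := by linarith
  have ha : 0 < (p - N) / (p - 1) := div_pos (by linarith) hp1
  have h0 : 0 < hw ((p - N) / (p - 1)) D r := by unfold hw; positivity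
  rw [← hw_pow1 hN hp hD hr]
  have : hw ((p - N) / (p - 1)) D r ^ p = hw ((p - N) / (p - 1)) D r ^ (p-1) * hw ((p - N) / (p - 1)) D r := by
    rw [Real.rpow_sub_one h0.ne']; field_simp
  rw [this]; ring

lemma young' {p t l : ℝ} (hp : 1 ≤ p) (ht : 0 ≤ t) (hl : 0 < l) :
    p * l ^ (p - 1) * t - (p - 1) * l ^ p ≤ t ^ p := by
  have h := one_add_mul_self_le_rpow_one_add (s := t / l - 1) (by have := div_nonneg ht hl.le; linarith) hp
  have e : 1 + (t / l - 1) = t / l := by ring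
  rw [e, Real.div_rpow ht hl.le, le_div_iff₀ (by positivity)] at h
  have : l ^ p = l ^ (p-1) * l := by
    rw [Real.rpow_sub_one hl.ne']; field_simp
  refine le_trans (le_of_eq ?_) h
  rw [this]; field_simp; ring

lemma cc_pos {N : ℕ} (hN : 2 ≤ N) {p D : ℝ} (hp : (N:ℝ) < p) (hD : 0 < D) : 0 < cc N p D := by
  have hN' : (2:ℝ) ≤ N := by exact_mod_cast hN
  have ha : 0 < (p - N) / (p - 1) := div_pos (by linarith) (by linarith)
  unfold cc; positivity

lemma ray_lower {N : ℕ} (hN : 2 ≤ N) {p D : ℝ} (hp : (N:ℝ) < p) (hD : 0 < D) (g : ℝ → ℝ)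
    (hg : Continuous g) (hg0 : ∀ r, 0 ≤ g r) (h1 : 1 ≤ ∫ r in (0:ℝ)..D, g r) :
    cc N p D ≤ ∫ r in (0:ℝ)..D, r ^ (N - 1) * g r ^ p := by
  have hN' : (2:ℝ) ≤ N := by exact_mod_cast hN
  have hp1 : 0 < p - 1 := by linarith
  have ha : 0 < (p - N) / (p - 1) := div_pos (by linarith) hp1
  have hc := cc_pos hN hp hD
  calc cc N p D ≤ p * cc N p D * (∫ r in (0:ℝ)..D, g r) - (p - 1) * cc N p D * ∫ r in (0:ℝ)..D, hw ((p - N) / (p - 1)) D r := by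
        rw [hw_int ha hD]
        have : 0 < p * cc N p D := by apply mul_pos _ hc; linarith
        nlinarith
    _ = ∫ r in (0:ℝ)..D, (p * cc N p D * g r - (p - 1) * cc N p D * hw ((p - N) / (p - 1)) D r) := by
        rw [intervalIntegral.integral_sub, intervalIntegral.integral_const_mul, intervalIntegral.integral_const_mul]
        · exact (hg.intervalIntegrable _ _).const_mul _
        · exact (hw_ii ha).const_mul _
    _ ≤ _ := by
        refine intervalIntegral.integral_mono_on_of_le_Ioo hD.le ?_ ?_ ?_
        · exact ((hg.intervalIntegrable _ _).const_mul _).sub ((hw_ii ha).const_mul _)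
        · apply Continuous.intervalIntegrable
          exact (continuous_pow _).mul (hg.rpow_const fun _ => Or.inr (by linarith))
        · intro r hr
          have hr0 := hr.1
          have h0 : 0 < hw ((p - N) / (p - 1)) D r := by unfold hw; positivity
          have := mul_le_mul_of_nonneg_left (young' (p := p) (by linarith) (hg0 r) h0) (pow_nonneg hr0.le (N-1))
          refine le_trans (le_of_eq ?_) this
          rw [mul_assoc (p-1), ← hw_pow hN hp hD hr0, ← hw_pow1 hN hp hD hr0]
          ring

lemma polar {N : ℕ} (hN : 2 ≤ N) (f : EuclideanSpace ℝ (Fin N) → ENNReal) (hf : Measurable f) :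
    ∫⁻ x, f x = ∫⁻ θ, (∫⁻ r in Set.Ioi (0:ℝ), ENNReal.ofReal (r ^ (N - 1)) * f (r • (θ : EuclideanSpace ℝ (Fin N))))
      ∂((volume : Measure (EuclideanSpace ℝ (Fin N))).toSphere) := by
  have : Nonempty (Fin N) := ⟨⟨0, by omega⟩⟩
  have hd : Module.finrank ℝ (EuclideanSpace ℝ (Fin N)) = N := by simp
  have key := MeasurePreserving.symm (homeomorphUnitSphereProd (EuclideanSpace ℝ (Fin N))).toMeasurableEquiv
    ((volume : Measure (EuclideanSpace ℝ (Fin N))).measurePreserving_homeomorphUnitSphereProd)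
  have k2 := key.lintegral_comp (f := fun x => f x.1) (hf.comp measurable_subtype_coe)
  rw [lintegral_subtype_comap (measurableSet_singleton _).compl, restrict_compl_singleton] at k2
  rw [← k2, lintegral_prod]
  · congr 1; ext θ
    rw [Measure.volumeIoiPow, lintegral_withDensity_eq_lintegral_mul, ← lintegral_subtype_comap measurableSet_Ioi, hd]
    · rfl
    · fun_prop
    · exact hf.comp (measurable_subtype_coe.comp ((MeasurableEquiv.measurable _).comp measurable_prodMk_left))
  · exact (hf.comp (measurable_subtype_coe.comp (MeasurableEquiv.measurable _))).aemeasurable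

lemma norm_gradient' {N : ℕ} (u : EuclideanSpace ℝ (Fin N) → ℝ) (x : EuclideanSpace ℝ (Fin N)) :
    ‖gradient u x‖ = ‖fderiv ℝ u x‖ := by
  rw [← toDual_gradient, LinearIsometryEquiv.norm_map]

lemma lower {N : ℕ} (hN : 2 ≤ N) {Ω : Set (EuclideanSpace ℝ (Fin N))} {p D : ℝ} (hp : (N:ℝ) < p) (hD : 0 < D)
    (hΩ : ∀ x ∈ Ω, ∀ y ∈ Ω, dist x y < D)
    (u : EuclideanSpace ℝ (Fin N) → ℝ) (hu : ContDiff ℝ (⊤ : ℕ∞) u) (hc : HasCompactSupport u)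
    (hs : tsupport u ⊆ Ω) (h1 : sSup ((fun x => |u x|) '' Ω) = 1) :
    N * (volume (ball (0 : EuclideanSpace ℝ (Fin N)) 1)).toReal * cc N p D ≤ ∫ x in Ω, ‖gradient u x‖ ^ p := by
  have hN' : (2:ℝ) ≤ N := by exact_mod_cast hN
  have hcu := hu.continuous
  have hcg : Continuous (fun x => ‖fderiv ℝ u x‖) := (hu.continuous_fderiv (by simp)).norm
  have hcgp : Continuous (fun x => ‖fderiv ℝ u x‖ ^ p) := hcg.rpow_const fun _ => Or.inr (by linarith)
  -- attained
  obtain ⟨x0, hx0, hx1⟩ : ∃ x0 ∈ Ω, 1 ≤ |u x0| := by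
    obtain ⟨x0, hm⟩ := (hcu.abs).exists_forall_ge_of_hasCompactSupport (by exact hc.abs)
    by_contra! hcon
    rcases eq_or_ne (u x0) 0 with h0 | h0
    · have : ∀ x, |u x| = 0 := fun x => le_antisymm (by simpa [h0] using hm x) (abs_nonneg _)
      have h2 : sSup ((fun x => |u x|) '' Ω) ≤ 0 := Real.sSup_le (by rintro _ ⟨x, _, rfl⟩; exact (this x).le) le_rfl
      linarith
    · have hx0 : x0 ∈ Ω := hs (subset_tsupport _ h0)
      have h2 : sSup ((fun x => |u x|) '' Ω) ≤ |u x0| := Real.sSup_le (by rintro _ ⟨x, _, rfl⟩; exact hm x) (abs_nonneg _)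
      linarith [hcon x0 hx0]
  -- integral over whole space
  have e1 : ∫ x in Ω, ‖gradient u x‖ ^ p = ∫ x, ‖fderiv ℝ u (x0 + x)‖ ^ p := by
    rw [integral_add_left_eq_self (fun x => ‖fderiv ℝ u x‖ ^ p) x0]
    simp_rw [norm_gradient']
    apply setIntegral_eq_integral_of_forall_compl_eq_zero
    intro x hx
    have : fderiv ℝ u x = 0 := by
      by_contra h
      exact hx (hs (support_fderiv_subset ℝ h))
    rw [this]; simp [Real.zero_rpow (show p ≠ 0 by linarith)]
  have hint : Integrable (fun x => ‖fderiv ℝ u (x0 + x)‖ ^ p) := by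
    apply Integrable.comp_add_left (f := fun x => ‖fderiv ℝ u x‖ ^ p)
    apply hcgp.integrable_of_hasCompactSupport
    refine (hc.fderiv ℝ).comp_left (g := fun L => ‖L‖ ^ p) ?_
    simp [Real.zero_rpow (show p ≠ 0 by linarith)]
  rw [e1, ← ENNReal.ofReal_le_ofReal_iff (by positivity), ofReal_integral_eq_lintegral_ofReal hint
    (Eventually.of_forall fun x => by positivity), polar hN]
  swap
  · exact (hcgp.comp (continuous_const.add continuous_id)).measurable.ennreal_ofReal
  have hray : ∀ θ : sphere (0 : EuclideanSpace ℝ (Fin N)) 1, ENNReal.ofReal (cc N p D) ≤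
      ∫⁻ r in Set.Ioi (0:ℝ), ENNReal.ofReal (r ^ (N - 1)) * ENNReal.ofReal (‖fderiv ℝ u (x0 + r • (θ : EuclideanSpace ℝ (Fin N)))‖ ^ p) := by
    intro θ
    have hθ : ‖(θ : EuclideanSpace ℝ (Fin N))‖ = 1 := by simpa using θ.2
    have hcr : Continuous fun r : ℝ => x0 + r • (θ : EuclideanSpace ℝ (Fin N)) := by fun_prop
    have hcF : Continuous fun r : ℝ => r ^ (N - 1) * ‖fderiv ℝ u (x0 + r • (θ : EuclideanSpace ℝ (Fin N)))‖ ^ p :=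
      (continuous_pow _).mul (hcgp.comp hcr)
    have hder : ∀ r : ℝ, HasDerivAt (fun r : ℝ => u (x0 + r • (θ : EuclideanSpace ℝ (Fin N))))
        (fderiv ℝ u (x0 + r • (θ : EuclideanSpace ℝ (Fin N))) θ) r := by
      intro r
      have h2 : HasDerivAt (fun r : ℝ => x0 + r • (θ : EuclideanSpace ℝ (Fin N))) (θ : EuclideanSpace ℝ (Fin N)) r := by
        simpa using ((hasDerivAt_id r).smul_const (θ : EuclideanSpace ℝ (Fin N))).const_add x0
      exact ((hu.differentiable (by simp)) _).hasFDerivAt.comp_hasDerivAt r h2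
    have hcd : Continuous fun r : ℝ => fderiv ℝ u (x0 + r • (θ : EuclideanSpace ℝ (Fin N))) θ :=
      ((hu.continuous_fderiv (by simp)).comp hcr).clm_apply continuous_const
    have hend : u (x0 + D • (θ : EuclideanSpace ℝ (Fin N))) = 0 := by
      by_contra h
      have := hΩ _ (hs (subset_tsupport _ h)) _ hx0
      simp [norm_smul, hθ, abs_of_pos hD] at this
    have h1 : 1 ≤ ∫ r in (0:ℝ)..D, ‖fderiv ℝ u (x0 + r • (θ : EuclideanSpace ℝ (Fin N)))‖ := by
      have ftc := intervalIntegral.integral_eq_sub_of_hasDerivAt (a := 0) (b := D) (fun r _ => hder r) (hcd.intervalIntegrable _ _)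
      rw [hend] at ftc
      simp only [zero_smul, add_zero, zero_sub] at ftc
      calc 1 ≤ |u x0| := hx1
        _ = |∫ r in (0:ℝ)..D, fderiv ℝ u (x0 + r • (θ : EuclideanSpace ℝ (Fin N))) θ| := by rw [ftc, abs_neg]
        _ ≤ ∫ r in (0:ℝ)..D, |fderiv ℝ u (x0 + r • (θ : EuclideanSpace ℝ (Fin N))) θ| := intervalIntegral.abs_integral_le_integral_abs hD.le
        _ ≤ _ := by
          apply intervalIntegral.integral_mono_on hD.le (hcd.abs.intervalIntegrable _ _) ((hcg.comp hcr).intervalIntegrable _ _)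
          intro r _
          have := (fderiv ℝ u (x0 + r • (θ : EuclideanSpace ℝ (Fin N)))).le_opNorm θ
          rwa [hθ, mul_one] at this
    have h2 := ray_lower hN hp hD _ (hcg.comp hcr) (fun _ => norm_nonneg _) h1
    calc ENNReal.ofReal (cc N p D) ≤ _ := ENNReal.ofReal_le_ofReal h2
      _ = ∫⁻ r in Set.Ioc (0:ℝ) D, ENNReal.ofReal (r ^ (N - 1) * ‖fderiv ℝ u (x0 + r • (θ : EuclideanSpace ℝ (Fin N)))‖ ^ p) := by
        rw [intervalIntegral.integral_of_le hD.le, ofReal_integral_eq_lintegral_ofReal]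
        · rfl
        · exact (hcF.intervalIntegrable 0 D).1
        · filter_upwards [ae_restrict_mem measurableSet_Ioc] with r hr
          have := hr.1
          simp only [Function.comp, Pi.zero_apply]
          positivity
      _ ≤ ∫⁻ r in Set.Ioi (0:ℝ), ENNReal.ofReal (r ^ (N - 1) * ‖fderiv ℝ u (x0 + r • (θ : EuclideanSpace ℝ (Fin N)))‖ ^ p) :=
        lintegral_mono_set Set.Ioc_subset_Ioi_self
      _ = _ := by
        apply setLIntegral_congr_fun measurableSet_Ioi
        intro r hr
        exact ENNReal.ofReal_mul (pow_nonneg (le_of_lt hr) _)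
  refine le_trans (le_of_eq ?_) (lintegral_mono hray)
  rw [lintegral_const, Measure.toSphere_apply_univ, mul_comm, ENNReal.ofReal_mul (cc_pos hN hp hD).le]
  congr 1
  rw [ENNReal.ofReal_mul (by positivity), ENNReal.ofReal_toReal measure_ball_lt_top.ne]
  simp

lemma upper_aux {N : ℕ} (hN : 2 ≤ N) {Ω : Set (EuclideanSpace ℝ (Fin N))} {p R m δ : ℝ} (hp : (N:ℝ) < p) (hR : 0 < R)
    (hm : 0 < m) (hδ : 0 < δ) (x0 : EuclideanSpace ℝ (Fin N)) (hΩ : closedBall x0 R ⊆ Ω) (k : ℝ → ℝ)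
    (hk : ContDiff ℝ (⊤ : ℕ∞) k) (hk0 : ∀ r, 0 ≤ k r) (hk1 : ∀ r ≤ δ, k r = 0) (hk2 : ∀ r, R ≤ r → k r = 0)
    (hkm : ∫ r in (0:ℝ)..R, k r = m) (hkh : ∀ r ∈ Set.Ioc 0 R, k r ≤ hw ((p - N) / (p - 1)) R r) :
    ∃ u : EuclideanSpace ℝ (Fin N) → ℝ,
    ContDiff ℝ (⊤ : ℕ∞) u ∧ HasCompactSupport u ∧ tsupport u ⊆ Ω ∧
    sSup ((fun x => |u x|) '' Ω) = 1 ∧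
    ∫ x in Ω, ‖gradient u x‖ ^ p ≤ N * (volume (ball (0 : EuclideanSpace ℝ (Fin N)) 1)).toReal * cc N p R / m ^ p := by
  have hN' : (2:ℝ) ≤ N := by exact_mod_cast hN
  have hp1 : 0 < p - 1 := by linarith
  have hp0 : 0 < p := by linarith
  have ha : 0 < (p - N) / (p - 1) := div_pos (by linarith) hp1
  have hkc := hk.continuous
  have : Nonempty (Fin N) := ⟨⟨0, by omega⟩⟩
  have hd : Module.finrank ℝ (EuclideanSpace ℝ (Fin N)) = N := by simp
  set G : ℝ → ℝ := fun r => 1 - (∫ s in (0:ℝ)..r, k s) / m with hG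
  have hGd : ∀ r, HasDerivAt G (-(k r / m)) r := fun r =>
    ((intervalIntegral.integral_hasDerivAt_right (hkc.intervalIntegrable _ _)
      (hkc.stronglyMeasurableAtFilter _ _) hkc.continuousAt).div_const m).const_sub 1
  have hGs : ContDiff ℝ (⊤ : ℕ∞) G := by
    rw [contDiff_infty_iff_deriv]
    refine ⟨fun r => (hGd r).differentiableAt, ?_⟩
    have : deriv G = fun r => -(k r / m) := funext fun r => (hGd r).deriv
    rw [this]
    exact (hk.div_const m).neg
  have hG1 : ∀ r, r ≤ δ → G r = 1 := by
    intro r hr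
    have : ∫ s in (0:ℝ)..r, k s = 0 := by
      apply intervalIntegral.integral_zero_ae
      refine Eventually.of_forall fun s hs => hk1 s ?_
      have := hs.2
      simp at this
      rcases this with h | h <;> linarith
    simp [hG, this]
  have hGR : ∀ r, R ≤ r → G r = 0 := by
    intro r hr
    have h2 : ∫ s in R..r, k s = 0 := by
      apply intervalIntegral.integral_zero_ae
      refine Eventually.of_forall fun s hs => hk2 s ?_
      rw [Set.uIoc_of_le hr] at hs; exact hs.1.le
    have := intervalIntegral.integral_add_adjacent_intervals (hkc.intervalIntegrable 0 R) (hkc.intervalIntegrable R r) (μ := volume)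
    simp only [hG]
    rw [← this, h2, hkm]; field_simp; ring
  have hanti : Antitone G := antitone_of_deriv_nonpos (fun r => (hGd r).differentiableAt)
    (fun r => by rw [(hGd r).deriv]; have := div_nonneg (hk0 r) hm.le; linarith)
  have hG01 : ∀ r, 0 ≤ G r ∧ G r ≤ 1 := by
    intro r
    constructor
    · rw [← hGR (max r R) (le_max_right _ _)]; exact hanti (le_max_left _ _)
    · rw [← hG1 (min r δ) (min_le_right _ _)]; exact hanti (min_le_left _ _)
  set u : EuclideanSpace ℝ (Fin N) → ℝ := fun x => G ‖x - x0‖ with hu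
  have hnear : u =ᶠ[𝓝 x0] fun _ => 1 := by
    filter_upwards [ball_mem_nhds x0 hδ] with x hx
    exact hG1 _ (by rw [← dist_eq_norm]; exact (mem_ball.1 hx).le)
  have hus : ContDiff ℝ (⊤ : ℕ∞) u := by
    rw [contDiff_iff_contDiffAt]
    intro x
    by_cases hx : x = x0
    · subst hx
      exact contDiffAt_const.congr_of_eventuallyEq hnear
    · have h1 : ContDiffAt ℝ (⊤ : ℕ∞) (fun x => ‖x - x0‖) x :=
        (contDiffAt_id.sub contDiffAt_const).norm ℝ (sub_ne_zero.2 hx)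
      exact hGs.contDiffAt.comp x h1
  have hts : tsupport u ⊆ closedBall x0 R := by
    apply closure_minimal _ isClosed_closedBall
    intro x hx
    by_contra h
    rw [mem_closedBall, not_le, dist_eq_norm] at h
    exact hx (hGR _ h.le)
  have hgrad : ∀ x, ‖gradient u x‖ ≤ k ‖x - x0‖ / m := by
    intro x
    rw [norm_gradient']
    by_cases hx : x = x0
    · subst hx
      rw [hnear.fderiv_eq]
      simp [hk1 0 hδ.le]
    · have h1 : DifferentiableAt ℝ (fun x => ‖x - x0‖) x :=
        (differentiableAt_id.sub_const x0).norm ℝ (sub_ne_zero.2 hx)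
      have h2 := (hGd ‖x - x0‖).comp_hasFDerivAt x h1.hasFDerivAt
      have h3 : fderiv ℝ u x = _ := h2.fderiv
      rw [h3, norm_smul, norm_neg, Real.norm_of_nonneg (div_nonneg (hk0 _) hm.le)]
      have h4 : ‖fderiv ℝ (fun x => ‖x - x0‖) x‖ ≤ ((1 : NNReal) : ℝ) := by
        apply norm_fderiv_le_of_lipschitz
        apply LipschitzWith.of_dist_le_mul
        intro y z
        rw [Real.dist_eq]
        simpa [dist_eq_norm] using abs_norm_sub_norm_le (y - x0) (z - x0)
      exact mul_le_of_le_one_right (div_nonneg (hk0 _) hm.le) h4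
  refine ⟨u, hus, (isCompact_closedBall x0 R).of_isClosed_subset (isClosed_tsupport u) hts, hts.trans hΩ, ?_, ?_⟩
  · apply IsGreatest.csSup_eq
    constructor
    · exact ⟨x0, hΩ (mem_closedBall_self hR.le), by simp [hu, hG1 0 hδ.le]⟩
    · rintro _ ⟨x, _, rfl⟩
      simp only [hu]
      rw [abs_of_nonneg (hG01 _).1]; exact (hG01 _).2
  · set F : ℝ → ℝ := fun r => (k r / m) ^ p with hF
    have hFc : Continuous F := (hkc.div_const m).rpow_const fun _ => Or.inr hp0.le
    have hF0 : ∀ r, 0 ≤ F r := fun r => Real.rpow_nonneg (div_nonneg (hk0 r) hm.le) _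
    have hFR : ∀ r, R ≤ r → F r = 0 := fun r hr => by simp [hF, hk2 r hr, Real.zero_rpow hp0.ne']
    have hFi : Integrable (fun x : EuclideanSpace ℝ (Fin N) => F ‖x - x0‖) := by
      apply Continuous.integrable_of_hasCompactSupport (by fun_prop)
      apply HasCompactSupport.intro (isCompact_closedBall x0 R)
      intro x hx
      rw [mem_closedBall, not_le, dist_eq_norm] at hx
      exact hFR _ hx.le
    have hle : ∀ x, ‖gradient u x‖ ^ p ≤ F ‖x - x0‖ := fun x =>
      Real.rpow_le_rpow (norm_nonneg _) (hgrad x) hp0.le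
    calc ∫ x in Ω, ‖gradient u x‖ ^ p ≤ ∫ x in Ω, F ‖x - x0‖ := by
          apply integral_mono_of_nonneg (Eventually.of_forall fun x => by positivity) hFi.integrableOn
            (Eventually.of_forall hle)
      _ ≤ ∫ x, F ‖x - x0‖ := setIntegral_le_integral hFi (Eventually.of_forall fun x => hF0 _)
      _ = ∫ x : EuclideanSpace ℝ (Fin N), F ‖x‖ := integral_sub_right_eq_self (fun x => F ‖x‖) x0
      _ = N * (volume (ball (0 : EuclideanSpace ℝ (Fin N)) 1)).toReal * ∫ r in Set.Ioi (0:ℝ), r ^ (N - 1) * F r := by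
          rw [integral_fun_norm_addHaar, hd]
          simp [Measure.real, mul_assoc]
      _ ≤ N * (volume (ball (0 : EuclideanSpace ℝ (Fin N)) 1)).toReal * (cc N p R / m ^ p) := by
          apply mul_le_mul_of_nonneg_left _ (by positivity)
          have e1 : ∫ r in Set.Ioi (0:ℝ), r ^ (N - 1) * F r = ∫ r in (0:ℝ)..R, r ^ (N - 1) * F r := by
            rw [intervalIntegral.integral_of_le hR.le]
            apply setIntegral_eq_of_subset_of_forall_sdiff_eq_zero measurableSet_Ioi Set.Ioc_subset_Ioi_self
            rintro r ⟨h1, h2⟩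
            rw [hFR r, mul_zero]
            by_contra h
            exact h2 ⟨h1, by linarith⟩
          have e2 : cc N p R / m ^ p = ∫ r in (0:ℝ)..R, cc N p R / m ^ p * hw ((p - N) / (p - 1)) R r := by
            rw [intervalIntegral.integral_const_mul, hw_int ha hR, mul_one]
          rw [e1, e2]
          apply intervalIntegral.integral_mono_on_of_le_Ioo hR.le
          · exact ((continuous_pow _).mul hFc).intervalIntegrable _ _
          · exact (hw_ii ha).const_mul _
          · intro r hr
            have := hw_pow hN hp hR hr.1
            have e : cc N p R / m ^ p * hw ((p - N) / (p - 1)) R r = r ^ (N - 1) * (hw ((p - N) / (p - 1)) R r / m) ^ p := by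
              rw [Real.div_rpow (hw_nonneg ha hR hr.1.le) hm.le, div_mul_eq_mul_div, ← this]; ring
            rw [e]
            apply mul_le_mul_of_nonneg_left _ (pow_nonneg hr.1.le _)
            apply Real.rpow_le_rpow (div_nonneg (hk0 r) hm.le) _ hp0.le
            exact div_le_div_of_nonneg_right (hkh r ⟨hr.1, hr.2.le⟩) hm.le
      _ = _ := by ring

noncomputable def eta (R : ℝ) (n : ℕ) (r : ℝ) : ℝ :=
  Real.smoothTransition ((n + 1) * r - 1) * Real.smoothTransition ((n + 1) * (R - r))

lemma eta_nonneg (R : ℝ) (n : ℕ) (r : ℝ) : 0 ≤ eta R n r :=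
  mul_nonneg (Real.smoothTransition.nonneg _) (Real.smoothTransition.nonneg _)
lemma eta_le (R : ℝ) (n : ℕ) (r : ℝ) : eta R n r ≤ 1 :=
  mul_le_one₀ (Real.smoothTransition.le_one _) (Real.smoothTransition.nonneg _) (Real.smoothTransition.le_one _)
lemma eta_zero1 (R : ℝ) (n : ℕ) (r : ℝ) (hr : r ≤ 1 / (n + 1)) : eta R n r = 0 := by
  have hn : (0:ℝ) < n + 1 := by positivity
  rw [le_div_iff₀ hn] at hr
  rw [eta, Real.smoothTransition.zero_of_nonpos (by linarith), zero_mul]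
lemma eta_zero2 (R : ℝ) (n : ℕ) (r : ℝ) (hr : R ≤ r) : eta R n r = 0 := by
  have hn : (0:ℝ) < n + 1 := by positivity
  rw [eta, Real.smoothTransition.zero_of_nonpos (x := (n + 1) * (R - r)) (by nlinarith), mul_zero]
lemma eta_contDiff (R : ℝ) (n : ℕ) : ContDiff ℝ (⊤ : ℕ∞) (eta R n) := by
  unfold eta
  exact (Real.smoothTransition.contDiff.comp (by fun_prop)).mul (Real.smoothTransition.contDiff.comp (by fun_prop))
lemma eta_tendsto {R r : ℝ} (h0 : 0 < r) (h1 : r < R) : Tendsto (fun n => eta R n r) atTop (𝓝 1) := by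
  apply tendsto_const_nhds.congr'
  have hn : Tendsto (fun n : ℕ => (n:ℝ) + 1) atTop atTop := tendsto_atTop_add_const_right _ _ tendsto_natCast_atTop_atTop
  filter_upwards [(hn.atTop_mul_const h0).eventually_ge_atTop 2, (hn.atTop_mul_const (sub_pos.2 h1)).eventually_ge_atTop 1] with n a b
  rw [eta, Real.smoothTransition.one_of_one_le (by linarith), Real.smoothTransition.one_of_one_le b, one_mul]

lemma upper {N : ℕ} (hN : 2 ≤ N) {Ω : Set (EuclideanSpace ℝ (Fin N))} {p R : ℝ} (hp : (N:ℝ) < p) (hR : 0 < R)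
    (x0 : EuclideanSpace ℝ (Fin N)) (hΩ : closedBall x0 R ⊆ Ω) :
    (∃ u : EuclideanSpace ℝ (Fin N) → ℝ,
    ContDiff ℝ (⊤ : ℕ∞) u ∧ HasCompactSupport u ∧ tsupport u ⊆ Ω ∧
    sSup ((fun x => |u x|) '' Ω) = 1) ∧
    LambdaP Ω p ≤ N * (volume (ball (0 : EuclideanSpace ℝ (Fin N)) 1)).toReal * cc N p R := by
  have hN' : (2:ℝ) ≤ N := by exact_mod_cast hN
  have hp1 : 0 < p - 1 := by linarith
  have ha : 0 < (p - N) / (p - 1) := div_pos (by linarith) hp1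
  set a := (p - N) / (p - 1) with hadef
  have hm : Tendsto (fun n => ∫ r in (0:ℝ)..R, eta R n r * hw a R r) atTop (𝓝 1) := by
    rw [← hw_int ha hR]
    apply intervalIntegral.tendsto_integral_filter_of_dominated_convergence (hw a R)
    · refine Eventually.of_forall fun n => ?_
      have := (hw_ii (D := R) ha).aestronglyMeasurable
      rw [Set.uIoc_of_le hR.le]
      exact (eta_contDiff R n).continuous.aestronglyMeasurable.mul this
    · refine Eventually.of_forall fun n => Eventually.of_forall fun r hr => ?_
      rw [Set.uIoc_of_le hR.le] at hr
      have := hw_nonneg ha hR hr.1.le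
      rw [Real.norm_of_nonneg (mul_nonneg (eta_nonneg _ _ _) this)]
      exact mul_le_of_le_one_left this (eta_le _ _ _)
    · exact hw_ii ha
    · have : ∀ᵐ r : ℝ, r ≠ R := by simp [ae_iff]
      filter_upwards [this] with r hrR hr
      rw [Set.uIoc_of_le hR.le] at hr
      simpa using (eta_tendsto hr.1 (lt_of_le_of_ne hr.2 hrR)).mul_const (hw a R r)
  have hex : ∀ᶠ n in atTop, ∃ u : EuclideanSpace ℝ (Fin N) → ℝ,
    ContDiff ℝ (⊤ : ℕ∞) u ∧ HasCompactSupport u ∧ tsupport u ⊆ Ω ∧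
    sSup ((fun x => |u x|) '' Ω) = 1 ∧
    ∫ x in Ω, ‖gradient u x‖ ^ p ≤ N * (volume (ball (0 : EuclideanSpace ℝ (Fin N)) 1)).toReal * cc N p R /
      (∫ r in (0:ℝ)..R, eta R n r * hw a R r) ^ p := by
    filter_upwards [hm.eventually (lt_mem_nhds one_pos)] with n hn
    have hδ : (0:ℝ) < 1 / (n + 1) := by positivity
    refine upper_aux hN hp hR hn hδ x0 hΩ (fun r => eta R n r * hw a R r) ?_ ?_ ?_ ?_ rfl ?_
    · rw [contDiff_iff_contDiffAt]
      intro r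
      rcases lt_or_ge 0 r with hr | hr
      · apply (eta_contDiff R n).contDiffAt.mul
        exact contDiffAt_const.mul (Real.contDiffAt_rpow_const_of_ne hr.ne')
      · apply (contDiffAt_const (c := (0:ℝ))).congr_of_eventuallyEq
        filter_upwards [Iio_mem_nhds (lt_of_le_of_lt hr hδ)] with s hs
        rw [eta_zero1 R n s (le_of_lt hs), zero_mul]
    · intro r
      rcases le_or_gt 0 r with hr | hr
      · exact mul_nonneg (eta_nonneg _ _ _) (hw_nonneg ha hR hr)
      · rw [eta_zero1 R n r (hr.le.trans hδ.le), zero_mul]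
    · intro r hr
      rw [eta_zero1 R n r hr, zero_mul]
    · intro r hr
      rw [eta_zero2 R n r hr, zero_mul]
    · intro r hr
      exact mul_le_of_le_one_left (hw_nonneg ha hR hr.1.le) (eta_le _ _ _)
  constructor
  · obtain ⟨n, u, h1, h2, h3, h4, _⟩ := hex.exists
    exact ⟨u, h1, h2, h3, h4⟩
  · have hlim : Tendsto (fun n => N * (volume (ball (0 : EuclideanSpace ℝ (Fin N)) 1)).toReal * cc N p R /
      (∫ r in (0:ℝ)..R, eta R n r * hw a R r) ^ p) atTop (𝓝 (N * (volume (ball (0 : EuclideanSpace ℝ (Fin N)) 1)).toReal * cc N p R / 1 ^ p)) :=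
      tendsto_const_nhds.div (hm.rpow_const (Or.inl one_ne_zero)) (by simp)
    rw [Real.one_rpow, div_one] at hlim
    refine ge_of_tendsto hlim ?_
    filter_upwards [hex] with n ⟨u, h1, h2, h3, h4, h5⟩
    refine le_trans (csInf_le ?_ ⟨u, h1, h2, h3, h4, rfl⟩) h5
    refine ⟨0, ?_⟩
    rintro _ ⟨v, _, _, _, _, rfl⟩
    positivity

theorem stmt8 {N : ℕ} (hN : 2 ≤ N) (Ω : Set (EuclideanSpace ℝ (Fin N)))
    (hΩo : IsOpen Ω) (hΩb : Bornology.IsBounded Ω) (hΩne : Ω.Nonempty) :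
    Tendsto (fun p => LambdaP Ω p / (p - N) ^ (p - 1)) (𝓝[>] (N : ℝ))
        (𝓝 (N * (volume (ball (0 : EuclideanSpace ℝ (Fin N)) 1)).toReal /
          ((N : ℝ) - 1) ^ ((N : ℝ) - 1))) ∧
    Tendsto (fun p => LambdaP Ω p) (𝓝[>] (N : ℝ)) (𝓝 0) := by
  have hN' : (2:ℝ) ≤ N := by exact_mod_cast hN
  obtain ⟨x0, hx0⟩ := hΩne
  obtain ⟨R, hR, hRΩ⟩ := Metric.nhds_basis_closedBall.mem_iff.1 (hΩo.mem_nhds hx0)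
  set D := Metric.diam Ω + 1 with hDdef
  have hD : 0 < D := by have := Metric.diam_nonneg (s := Ω); linarith
  have hdist : ∀ x ∈ Ω, ∀ y ∈ Ω, dist x y < D := fun x hx y hy => by
    have := Metric.dist_le_diam_of_mem hΩb hx hy; linarith
  set W := N * (volume (ball (0 : EuclideanSpace ℝ (Fin N)) 1)).toReal with hW
  have hlow : ∀ p : ℝ, (N:ℝ) < p → W * cc N p D ≤ LambdaP Ω p := by
    intro p hp
    obtain ⟨⟨u, h1, h2, h3, h4⟩, _⟩ := upper hN hp hR x0 hRΩ
    unfold LambdaP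
    refine le_csInf ⟨_, u, h1, h2, h3, h4, rfl⟩ ?_
    rintro _ ⟨v, g1, g2, g3, g4, rfl⟩
    exact lower hN hp hD hdist v g1 g2 g3 g4
  have hup : ∀ p : ℝ, (N:ℝ) < p → LambdaP Ω p ≤ W * cc N p R := fun p hp => (upper hN hp hR x0 hRΩ).2
  have hcc : ∀ d : ℝ, ∀ p : ℝ, (N:ℝ) < p →
      W * cc N p d / (p - N) ^ (p - 1) = W / (p - 1) ^ (p - 1) * d ^ (-(p - N)) := by
    intro d p hp
    have h1 : 0 < p - N := by linarith
    have h2 : 0 < p - 1 := by linarith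
    have h3 : 0 < (p - N) ^ (p - 1) := by positivity
    have h4 : 0 < (p - 1) ^ (p - 1) := by positivity
    rw [cc, Real.div_rpow h1.le h2.le]
    field_simp
  have hl : ∀ d : ℝ, 0 < d → Tendsto (fun p => W * cc N p d / (p - N) ^ (p - 1)) (𝓝[>] (N : ℝ))
      (𝓝 (W / ((N : ℝ) - 1) ^ ((N : ℝ) - 1))) := by
    intro d hd
    have h : ContinuousAt (fun p : ℝ => W / (p - 1) ^ (p - 1) * d ^ (-(p - N))) N := by
      have h1 : (0:ℝ) < N - 1 := by linarith
      have c1 : ContinuousAt (fun p : ℝ => p - 1) N := by fun_prop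
      have c2 : ContinuousAt (fun p : ℝ => -(p - N)) N := by fun_prop
      refine (continuousAt_const.div (c1.rpow c1 (Or.inl h1.ne')) ?_).mul
        (continuousAt_const.rpow c2 (Or.inl hd.ne'))
      positivity
    have h2 := h.tendsto.mono_left (nhdsWithin_le_nhds (s := Set.Ioi (N:ℝ)))
    simp only [sub_self, neg_zero, Real.rpow_zero, mul_one] at h2
    refine h2.congr' ?_
    filter_upwards [self_mem_nhdsWithin] with p hp
    exact (hcc d p hp).symm
  have main : Tendsto (fun p => LambdaP Ω p / (p - N) ^ (p - 1)) (𝓝[>] (N : ℝ))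
      (𝓝 (W / ((N : ℝ) - 1) ^ ((N : ℝ) - 1))) := by
    refine tendsto_of_tendsto_of_tendsto_of_le_of_le' (hl D hD) (hl R hR) ?_ ?_
    · filter_upwards [self_mem_nhdsWithin] with p hp
      exact div_le_div_of_nonneg_right (hlow p hp) (Real.rpow_nonneg (sub_nonneg.2 (le_of_lt hp)) _)
    · filter_upwards [self_mem_nhdsWithin] with p hp
      exact div_le_div_of_nonneg_right (hup p hp) (Real.rpow_nonneg (sub_nonneg.2 (le_of_lt hp)) _)
  refine ⟨main, ?_⟩
  have hz : Tendsto (fun p : ℝ => (p - N) ^ (p - 1)) (𝓝[>] (N : ℝ)) (𝓝 0) := by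
    have c1 : ContinuousAt (fun p : ℝ => p - 1) N := by fun_prop
    have c2 : ContinuousAt (fun p : ℝ => p - N) N := by fun_prop
    have h := (c2.rpow c1 (Or.inr (by linarith))).tendsto.mono_left (nhdsWithin_le_nhds (s := Set.Ioi (N:ℝ)))
    rwa [sub_self, Real.zero_rpow (by linarith)] at h
  have h := main.mul hz
  rw [mul_zero] at h
  refine h.congr' ?_
  filter_upwards [self_mem_nhdsWithin] with p hp
  exact div_mul_cancel₀ _ (Real.rpow_pos_of_pos (sub_pos.2 hp) _).ne'
end

section
/- The function p ↦ Λ_p(Ω)^{1/p} |Ω|^{−1/p} is monotone non-decreasing on (N, ∞); that is, for all N < p₁ < p₂, Λ_{p₁}(Ω)^{1/p₁} |Ω|^{−1/p₁} ≤ Λ_{p₂}(Ω)^{1/p₂} |Ω|^{−1/p₂}. -/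
open MeasureTheory Filter Topology Metric

lemma holder_aux {N : ℕ} (Ω : Set (EuclideanSpace ℝ (Fin N)))
    (hΩb : Bornology.IsBounded Ω)
    (p₁ p₂ : ℝ) (hp₁ : 0 < p₁) (hp₁₂ : p₁ < p₂)
    (u : EuclideanSpace ℝ (Fin N) → ℝ) (hu : ContDiff ℝ (⊤ : ℕ∞) u) (hc : HasCompactSupport u) :
    ∫ x in Ω, ‖gradient u x‖ ^ p₁ ≤
      (∫ x in Ω, ‖gradient u x‖ ^ p₂) ^ (p₁ / p₂) * (volume Ω).toReal ^ (1 - p₁ / p₂) := by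
  have hp₂ : 0 < p₂ := hp₁.trans hp₁₂
  have hfin : volume Ω < ⊤ := hΩb.measure_lt_top
  haveI : IsFiniteMeasure (volume.restrict Ω) := ⟨by simpa using hfin⟩
  have hn : ∀ x, ‖gradient u x‖ = ‖fderiv ℝ u x‖ := fun x => by
    simp [gradient]
  simp only [hn]
  have hcont : Continuous (fun x => ‖fderiv ℝ u x‖ ^ p₁) := by
    have : Continuous (fderiv ℝ u) := hu.continuous_fderiv (by simp)
    exact this.norm.rpow_const (fun x => Or.inr hp₁.le)
  have hcs : HasCompactSupport (fun x => ‖fderiv ℝ u x‖ ^ p₁) :=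
    (hc.fderiv (𝕜 := ℝ)).comp_left (g := fun z => ‖z‖ ^ p₁) (by simp [hp₁.ne'])
  have hr : 1 < p₂ / p₁ := by rwa [one_lt_div hp₁]
  have hpq := Real.HolderConjugate.conjExponent hr
  have key := integral_mul_le_Lp_mul_Lq_of_nonneg (μ := volume.restrict Ω) hpq
    (f := fun x => ‖fderiv ℝ u x‖ ^ p₁) (g := fun _ => (1:ℝ))
    (Eventually.of_forall fun x => by positivity) (Eventually.of_forall fun x => by simp)
    ((hcont.memLp_of_hasCompactSupport hcs).restrict _) (memLp_const _)
  have e1 : ∀ x, (‖fderiv ℝ u x‖ ^ p₁) ^ (p₂ / p₁) = ‖fderiv ℝ u x‖ ^ p₂ := fun x => by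
    rw [← Real.rpow_mul (norm_nonneg _)]; congr 1; field_simp
  have e2 : 1 / (p₂ / p₁).conjExponent = 1 - p₁ / p₂ := by
    have := hpq.inv_add_inv_eq_one
    rw [inv_div] at this
    rw [one_div]; linarith
  rw [e2, one_div_div] at key
  simpa [e1, Measure.real] using key

theorem stmt10 {N : ℕ} (hN : 2 ≤ N) (Ω : Set (EuclideanSpace ℝ (Fin N)))
    (hΩo : IsOpen Ω) (hΩb : Bornology.IsBounded Ω) (hΩne : Ω.Nonempty)
    (p₁ p₂ : ℝ) (hp₁ : (N : ℝ) < p₁) (hp₁₂ : p₁ < p₂) :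
    LambdaP Ω p₁ ^ (1 / p₁) * (volume Ω).toReal ^ (-(1 / p₁)) ≤
      LambdaP Ω p₂ ^ (1 / p₂) * (volume Ω).toReal ^ (-(1 / p₂)) := by
  have h1 : 0 < p₁ := lt_of_le_of_lt (Nat.cast_nonneg N) hp₁
  have h2 : 0 < p₂ := h1.trans hp₁₂
  have hV : 0 < (volume Ω).toReal :=
    ENNReal.toReal_pos (hΩo.measure_pos volume hΩne).ne' hΩb.measure_lt_top.ne
  set V := (volume Ω).toReal with hVdef
  have hInn : ∀ (p : ℝ) (u : EuclideanSpace ℝ (Fin N) → ℝ),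
      0 ≤ ∫ x in Ω, ‖gradient u x‖ ^ p := fun p u => integral_nonneg fun x => by positivity
  have hL : ∀ p, 0 ≤ LambdaP Ω p := fun p => by
    apply Real.sInf_nonneg
    rintro c ⟨u, -, -, -, -, rfl⟩
    exact hInn p u
  by_cases hex : ∃ u : EuclideanSpace ℝ (Fin N) → ℝ,
    ContDiff ℝ (⊤ : ℕ∞) u ∧ HasCompactSupport u ∧ tsupport u ⊆ Ω ∧
    sSup ((fun x => |u x|) '' Ω) = 1
  swap
  · have h0 : LambdaP Ω p₁ = 0 := by
      unfold LambdaP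
      convert Real.sInf_empty
      ext c
      simp only [Set.mem_setOf_eq, Set.mem_empty_iff_false, iff_false]
      rintro ⟨u, a, b, c, d, -⟩
      exact hex ⟨u, a, b, c, d⟩
    rw [h0, Real.zero_rpow (by positivity), zero_mul]
    have := hL p₂
    positivity
  have main : (LambdaP Ω p₁ ^ (1 / p₁) * V ^ (-(1 / p₁)) * V ^ (1 / p₂)) ^ p₂ ≤ LambdaP Ω p₂ := by
    obtain ⟨u, a, b, c, d⟩ := hex
    refine le_csInf (s := { c : ℝ | ∃ u : EuclideanSpace ℝ (Fin N) → ℝ,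
      ContDiff ℝ (⊤ : ℕ∞) u ∧ HasCompactSupport u ∧ tsupport u ⊆ Ω ∧
      sSup ((fun x => |u x|) '' Ω) = 1 ∧
      c = ∫ x in Ω, ‖gradient u x‖ ^ p₂ }) ⟨_, u, a, b, c, d, rfl⟩ ?_
    rintro _ ⟨u, a, b, c, d, rfl⟩
    have hle : LambdaP Ω p₁ ≤ ∫ x in Ω, ‖gradient u x‖ ^ p₁ := by
      refine csInf_le ⟨0, ?_⟩ ⟨u, a, b, c, d, rfl⟩
      rintro _ ⟨u, -, -, -, -, rfl⟩
      exact hInn _ u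
    have hh := hle.trans (holder_aux Ω hΩb p₁ p₂ h1 hp₁₂ u a b)
    rw [← hVdef] at hh
    have hI := hInn p₂ u
    generalize (∫ x in Ω, ‖gradient u x‖ ^ p₂) = I at hh hI ⊢
    have hh' : LambdaP Ω p₁ ^ (1 / p₁) ≤ I ^ (1 / p₂) * V ^ (1 / p₁ - 1 / p₂) := by
      refine (Real.rpow_le_rpow (hL _) hh (by positivity)).trans_eq ?_
      rw [Real.mul_rpow (by positivity) (by positivity), ← Real.rpow_mul hI, ← Real.rpow_mul hV.le]
      congr 2 <;> field_simp
    have hL1 := hL p₁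
    calc _ ≤ (I ^ (1 / p₂) * V ^ (1 / p₁ - 1 / p₂) * V ^ (-(1 / p₁)) * V ^ (1 / p₂)) ^ p₂ := by
          gcongr
      _ = (I ^ (1 / p₂)) ^ p₂ := by
          rw [mul_assoc, mul_assoc, ← Real.rpow_add hV, ← Real.rpow_add hV]
          ring_nf; simp
      _ = I := by rw [← Real.rpow_mul hI, one_div_mul_cancel h2.ne', Real.rpow_one]
  have hL1 := hL p₁
  have m2 := Real.rpow_le_rpow (by positivity) main (z := 1 / p₂) (by positivity)
  rw [← Real.rpow_mul (by positivity), mul_one_div_cancel h2.ne', Real.rpow_one] at m2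
  rw [Real.rpow_neg hV.le (1 / p₂), ← div_eq_mul_inv, le_div_iff₀ (by positivity)]
  exact m2
end

section
/- For every p > N, Λ_p(Ω) ≤ |Ω| / (‖ρ‖_∞)^p, where ρ(x) := dist(x, Ωᶜ) is the distance function to the boundary and ‖ρ‖_∞ := sup_{x∈Ω} ρ(x). Equivalently, Λ_p(Ω)^{1/p} |Ω|^{−1/p} ≤ 1/‖ρ‖_∞ for all p > N. -/
open MeasureTheory Filter Topology Metric

lemma exists_smooth_bump {N : ℕ} (x0 : EuclideanSpace ℝ (Fin N)) (r δ : ℝ) (hr : 0 < r)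
    (hδ : 0 < δ) :
    ∃ v : EuclideanSpace ℝ (Fin N) → ℝ, ContDiff ℝ (⊤ : ℕ∞) v ∧
      tsupport v ⊆ closedBall x0 (r + δ) ∧ r - δ ≤ v x0 ∧ LipschitzWith 1 v := by
  let φ : ContDiffBump (0 : EuclideanSpace ℝ (Fin N)) := ⟨δ / 2, δ, by linarith, by linarith⟩
  let g : EuclideanSpace ℝ (Fin N) → ℝ := fun x => max (r - dist x x0) 0
  have hgl : ∀ x y, |g x - g y| ≤ dist x y := by
    intro x y
    have h1 := abs_max_sub_max_le_abs (r - dist x x0) (r - dist y x0) 0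
    have h2 := abs_dist_sub_le x y x0
    have h3 : |r - dist x x0 - (r - dist y x0)| = |dist x x0 - dist y x0| := by
      rw [abs_sub_comm]; congr 1; ring
    rw [h3] at h1
    exact h1.trans h2
  have hgc : Continuous g := by fun_prop
  have hint : ∀ x, Integrable (fun t => φ.normed volume t * g (x - t)) := by
    intro x
    refine Continuous.integrable_of_hasCompactSupport ?_ ?_
    · exact φ.continuous_normed.mul (by fun_prop)
    · exact (φ.hasCompactSupport_normed).mul_right
  let v := MeasureTheory.convolution (φ.normed volume) g (ContinuousLinearMap.lsmul ℝ ℝ) volume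
  have hv : ∀ x, v x = ∫ t, φ.normed volume t * g (x - t) := fun x => rfl
  refine ⟨v, ?_, ?_, ?_, ?_⟩
  · exact HasCompactSupport.contDiff_convolution_left _ φ.hasCompactSupport_normed
      φ.contDiff_normed hgc.locallyIntegrable
  · refine closure_minimal ?_ isClosed_closedBall
    refine (support_convolution_subset _).trans ?_
    rintro _ ⟨a, ha, b, hb, rfl⟩
    rw [φ.support_normed_eq] at ha
    have hb' : dist b x0 < r := by
      by_contra h
      apply hb
      exact max_eq_right (by linarith)
    have ha' : dist a 0 < δ := ha
    rw [dist_zero_right] at ha'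
    simp only [mem_closedBall]
    rw [dist_eq_norm] at *
    have : a + b - x0 = a + (b - x0) := by abel
    rw [this]
    linarith [norm_add_le a (b - x0)]
  · have h := φ.dist_normed_convolution_le (μ := volume) (g := g) (x₀ := x0) (ε := δ)
      hgc.aestronglyMeasurable (by
        intro x hx
        have hx' : dist x x0 < δ := hx
        rw [Real.dist_eq]
        exact (hgl x x0).trans hx'.le)
    have h2 : g x0 = r := by simp [g, hr.le]
    rw [h2, Real.dist_eq] at h
    have := abs_le.1 h
    change r - δ ≤ v x0
    linarith [this.1]
  · refine LipschitzWith.of_dist_le_mul ?_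
    intro x y
    rw [Real.dist_eq, hv, hv, ← integral_sub (hint x) (hint y), NNReal.coe_one, one_mul]
    calc |∫ t, (φ.normed volume t * g (x - t) - φ.normed volume t * g (y - t))|
        ≤ ∫ t, φ.normed volume t * dist x y := by
          rw [← Real.norm_eq_abs]
          refine norm_integral_le_of_norm_le (φ.integrable_normed.mul_const _) ?_
          refine Eventually.of_forall fun t => ?_
          rw [← mul_sub, Real.norm_eq_abs, abs_mul, abs_of_nonneg (φ.nonneg_normed t)]
          refine mul_le_mul_of_nonneg_left ?_ (φ.nonneg_normed t)
          have := hgl (x - t) (y - t)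
          rwa [dist_sub_right] at this
      _ = dist x y := by rw [integral_mul_const, φ.integral_normed, one_mul]

open scoped Pointwise in
lemma LambdaP_le_aux {N : ℕ} (Ω : Set (EuclideanSpace ℝ (Fin N)))
    (hΩb : Bornology.IsBounded Ω) (hc : Ωᶜ.Nonempty)
    (p : ℝ) (hp : 0 < p) (s : ℝ) (hs : 0 < s) (x0 : EuclideanSpace ℝ (Fin N)) (hx0 : x0 ∈ Ω)
    (hst : s < infDist x0 Ωᶜ) :
    LambdaP Ω p ≤ (volume Ω).toReal / s ^ p := by
  set t := infDist x0 Ωᶜ with ht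
  obtain ⟨v, hv1, hv2, hv3, hv4⟩ := exists_smooth_bump x0 ((s + t) / 2) ((t - s) / 4)
    (by linarith) (by linarith)
  have hsub : closedBall x0 ((s + t) / 2 + (t - s) / 4) ⊆ Ω := by
    intro y hy
    by_contra hy'
    have h1 : infDist x0 Ωᶜ ≤ dist x0 y := infDist_le_dist_of_mem hy'
    rw [mem_closedBall, dist_comm] at hy
    linarith
  have hcs : HasCompactSupport v :=
    (isCompact_closedBall x0 _).of_isClosed_subset (isClosed_tsupport v) hv2
  obtain ⟨C, hC⟩ := hv1.continuous.bounded_above_of_compact_support hcs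
  have hbdd : BddAbove ((fun x => |v x|) '' Ω) := by
    refine ⟨C, ?_⟩
    rintro _ ⟨x, _, rfl⟩
    exact hC x
  set M := sSup ((fun x => |v x|) '' Ω) with hM
  have hsM : s ≤ M := by
    have h1 : |v x0| ≤ M := le_csSup hbdd ⟨x0, hx0, rfl⟩
    have h2 := le_abs_self (v x0)
    linarith
  have hM0 : 0 < M := hs.trans_le hsM
  have hgrad : ∀ x, ‖gradient (fun x => M⁻¹ * v x) x‖ ≤ s⁻¹ := by
    intro x
    have h1 : ‖gradient (fun x => M⁻¹ * v x) x‖ = ‖fderiv ℝ (fun x => M⁻¹ * v x) x‖ := by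
      simp [gradient]
    rw [h1, fderiv_const_mul (hv1.differentiable (by simp) x), norm_smul,
      Real.norm_of_nonneg (by positivity)]
    have h2 : ‖fderiv ℝ v x‖ ≤ 1 := by
      simpa using norm_fderiv_le_of_lipschitz ℝ hv4 (x₀ := x)
    calc M⁻¹ * ‖fderiv ℝ v x‖ ≤ M⁻¹ * 1 := by gcongr
      _ ≤ s⁻¹ := by rw [mul_one]; gcongr
  have hfin : volume Ω < ⊤ := hΩb.measure_lt_top
  calc LambdaP Ω p ≤ ∫ x in Ω, ‖gradient (fun x => M⁻¹ * v x) x‖ ^ p := by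
        refine csInf_le ⟨0, ?_⟩ ⟨fun x => M⁻¹ * v x, ?_, ?_, ?_, ?_, rfl⟩
        · rintro _ ⟨u, _, _, _, _, rfl⟩
          exact integral_nonneg fun x => by positivity
        · exact contDiff_const.mul hv1
        · exact hcs.mul_left
        · exact (tsupport_mul_subset_right (f := fun _ => M⁻¹) (g := v)).trans (hv2.trans hsub)
        · have : (fun x => |M⁻¹ * v x|) '' Ω = M⁻¹ • ((fun x => |v x|) '' Ω) := by
            rw [← Set.image_smul, Set.image_image]
            refine Set.image_congr fun x _ => ?_
            rw [abs_mul, abs_of_pos (inv_pos.2 hM0), smul_eq_mul]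
          rw [this, Real.sSup_smul_of_nonneg (by positivity), ← hM, smul_eq_mul,
            inv_mul_cancel₀ hM0.ne']
    _ ≤ ‖∫ x in Ω, ‖gradient (fun x => M⁻¹ * v x) x‖ ^ p‖ := le_abs_self _
    _ ≤ (s⁻¹) ^ p * (volume Ω).toReal := by
        refine norm_setIntegral_le_of_norm_le_const hfin fun x _ => ?_
        rw [Real.norm_of_nonneg (by positivity)]
        exact Real.rpow_le_rpow (norm_nonneg _) (hgrad x) hp.le
    _ = (volume Ω).toReal / s ^ p := by
        rw [Real.inv_rpow hs.le]; ring

theorem stmt11 {N : ℕ} (hN : 2 ≤ N) (Ω : Set (EuclideanSpace ℝ (Fin N)))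
    (hΩo : IsOpen Ω) (hΩb : Bornology.IsBounded Ω) (hΩne : Ω.Nonempty)
    (p : ℝ) (hp : (N : ℝ) < p) :
    LambdaP Ω p ≤
      (volume Ω).toReal / (sSup ((fun x => infDist x Ωᶜ) '' Ω)) ^ p ∧
    LambdaP Ω p ^ (1 / p) * (volume Ω).toReal ^ (-(1 / p)) ≤
      1 / sSup ((fun x => infDist x Ωᶜ) '' Ω) := by
  have hp0 : 0 < p := lt_of_le_of_lt (Nat.cast_nonneg N) hp
  haveI : Nonempty (Fin N) := ⟨⟨0, by omega⟩⟩
  have hc : Ωᶜ.Nonempty := by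
    rw [Set.nonempty_compl]
    rintro rfl
    exact NormedSpace.unbounded_univ ℝ _ hΩb
  have hfin : volume Ω < ⊤ := hΩb.measure_lt_top
  have hpos : 0 < (volume Ω).toReal :=
    ENNReal.toReal_pos (hΩo.measure_pos volume hΩne).ne' hfin.ne
  set R := sSup ((fun x => infDist x Ωᶜ) '' Ω) with hR
  have hbdd : BddAbove ((fun x => infDist x Ωᶜ) '' Ω) := by
    obtain ⟨y, hy⟩ := hc
    obtain ⟨C, hC⟩ := hΩb.subset_closedBall y
    refine ⟨C, ?_⟩
    rintro _ ⟨x, hx, rfl⟩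
    exact (infDist_le_dist_of_mem hy).trans (hC hx)
  have hRpos : 0 < R := by
    obtain ⟨x, hx⟩ := hΩne
    have h1 : 0 < infDist x Ωᶜ :=
      (hΩo.isClosed_compl.notMem_iff_infDist_pos hc).1 (by simpa using hx)
    exact h1.trans_le (le_csSup hbdd ⟨x, hx, rfl⟩)
  have key : ∀ s, 0 < s → s < R → LambdaP Ω p ≤ (volume Ω).toReal / s ^ p := by
    intro s hs hsR
    obtain ⟨_, ⟨x0, hx0, rfl⟩, h⟩ := exists_lt_of_lt_csSup (hΩne.image _) hsR
    exact LambdaP_le_aux Ω hΩb hc p hp0 s hs x0 hx0 h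
  have h1 : LambdaP Ω p ≤ (volume Ω).toReal / R ^ p := by
    have hcont : ContinuousAt (fun s : ℝ => (volume Ω).toReal / s ^ p) R :=
      continuousAt_const.div (Real.continuousAt_rpow_const _ _ (Or.inl hRpos.ne'))
        (Real.rpow_pos_of_pos hRpos p).ne'
    refine ge_of_tendsto (hcont.tendsto.mono_left (nhdsWithin_le_nhds (s := Set.Iio R))) ?_
    filter_upwards [Ioo_mem_nhdsLT hRpos] with s hs
    exact key s hs.1 hs.2
  refine ⟨h1, ?_⟩
  have h0 : 0 ≤ LambdaP Ω p := by
    refine Real.sInf_nonneg ?_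
    rintro _ ⟨u, _, _, _, _, rfl⟩
    exact integral_nonneg fun x => by positivity
  have h2 := Real.rpow_le_rpow h0 h1 (by positivity : 0 ≤ 1 / p)
  rw [Real.div_rpow hpos.le (by positivity), ← Real.rpow_mul hRpos.le,
    mul_one_div_cancel hp0.ne', Real.rpow_one] at h2
  rw [Real.rpow_neg hpos.le, ← div_eq_mul_inv, div_le_iff₀ (by positivity)]
  rw [one_div_mul_eq_div]
  exact h2
end
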